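/- For all positive semidefinite matrices Σ and X, the matrix-valued function ε ↦ ρ(Σ + εX) is differentiable at ε = 0 and its derivative there equals Ã(Σ) X Ã(Σ)ᵀ. -/

import Mathlib

open Matrix BigOperators

noncomputable section

/-- `R̃(Σ) = C (A Σ Aᵀ + Q) Cᵀ + R`. -/
def Rt {ny nz : ℕ} (A Q : Matrix (Fin ny) (Fin ny) ℝ)
    (C : Matrix (Fin nz) (Fin ny) ℝ) (R : Matrix (Fin nz) (Fin nz) ℝ)
    (S : Matrix (Fin ny) (Fin ny) ℝ) : Matrix (Fin nz) (Fin nz) ℝ :=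
  C * (A * S * Aᵀ + Q) * Cᵀ + R

/-- Optimal unknown-input filter gain `M(Σ)`. -/
def Mg {ny nz nd : ℕ} (A Q : Matrix (Fin ny) (Fin ny) ℝ) (G : Matrix (Fin ny) (Fin nd) ℝ)
    (C : Matrix (Fin nz) (Fin ny) ℝ) (R : Matrix (Fin nz) (Fin nz) ℝ)
    (S : Matrix (Fin ny) (Fin ny) ℝ) : Matrix (Fin nd) (Fin nz) ℝ :=
  ((C * G)ᵀ * (Rt A Q C R S)⁻¹ * (C * G))⁻¹ * (C * G)ᵀ * (Rt A Q C R S)⁻¹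

/-- Optimal state filter gain `K(Σ)`. -/
def Kg {ny nz : ℕ} (A Q : Matrix (Fin ny) (Fin ny) ℝ)
    (C : Matrix (Fin nz) (Fin ny) ℝ) (R : Matrix (Fin nz) (Fin nz) ℝ)
    (S : Matrix (Fin ny) (Fin ny) ℝ) : Matrix (Fin ny) (Fin nz) ℝ :=
  (A * S * Aᵀ + Q) * Cᵀ * (Rt A Q C R S)⁻¹

/-- Closed loop matrix `Ã(Σ)`. -/
def Atil {ny nz nd : ℕ} (A Q : Matrix (Fin ny) (Fin ny) ℝ) (G : Matrix (Fin ny) (Fin nd) ℝ)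
    (C : Matrix (Fin nz) (Fin ny) ℝ) (R : Matrix (Fin nz) (Fin nz) ℝ)
    (S : Matrix (Fin ny) (Fin ny) ℝ) : Matrix (Fin ny) (Fin ny) ℝ :=
  (1 - Kg A Q C R S * C) * (1 - G * Mg A Q G C R S * C) * A

/-- `F̃(Σ)`. -/
def Ftil {ny nz nd : ℕ} (A Q : Matrix (Fin ny) (Fin ny) ℝ) (G : Matrix (Fin ny) (Fin nd) ℝ)
    (C : Matrix (Fin nz) (Fin ny) ℝ) (R : Matrix (Fin nz) (Fin nz) ℝ)
    (S : Matrix (Fin ny) (Fin ny) ℝ) : Matrix (Fin ny) (Fin ny) ℝ :=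
  -((1 - Kg A Q C R S * C) * (1 - G * Mg A Q G C R S * C))

/-- `W̃(Σ)`. -/
def Wtil {ny nz nd : ℕ} (A Q : Matrix (Fin ny) (Fin ny) ℝ) (G : Matrix (Fin ny) (Fin nd) ℝ)
    (C : Matrix (Fin nz) (Fin ny) ℝ) (R : Matrix (Fin nz) (Fin nz) ℝ)
    (S : Matrix (Fin ny) (Fin ny) ℝ) : Matrix (Fin ny) (Fin nz) ℝ :=
  G * Mg A Q G C R S - Kg A Q C R S * C * G * Mg A Q G C R S + Kg A Q C R S

/-- The state error covariance update map `ρ(Σ)`. -/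
def rho {ny nz nd : ℕ} (A Q : Matrix (Fin ny) (Fin ny) ℝ) (G : Matrix (Fin ny) (Fin nd) ℝ)
    (C : Matrix (Fin nz) (Fin ny) ℝ) (R : Matrix (Fin nz) (Fin nz) ℝ)
    (S : Matrix (Fin ny) (Fin ny) ℝ) : Matrix (Fin ny) (Fin ny) ℝ :=
  Atil A Q G C R S * S * (Atil A Q G C R S)ᵀ
    + Ftil A Q G C R S * Q * (Ftil A Q G C R S)ᵀ
    + Wtil A Q G C R S * R * (Wtil A Q G C R S)ᵀ

/-- The unknown-input error covariance update map `ρᵈ(Σ)`. -/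
def rhod {ny nz nd : ℕ} (A Q : Matrix (Fin ny) (Fin ny) ℝ) (G : Matrix (Fin ny) (Fin nd) ℝ)
    (C : Matrix (Fin nz) (Fin ny) ℝ) (R : Matrix (Fin nz) (Fin nz) ℝ)
    (S : Matrix (Fin ny) (Fin ny) ℝ) : Matrix (Fin nd) (Fin nd) ℝ :=
  ((C * G)ᵀ * (Rt A Q C R S)⁻¹ * (C * G))⁻¹

attribute [local instance] Matrix.normedAddCommGroup Matrix.normedSpace

lemma Vt_eq {ny nz nd : ℕ} (A Q : Matrix (Fin ny) (Fin ny) ℝ) (G : Matrix (Fin ny) (Fin nd) ℝ)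
    (C : Matrix (Fin nz) (Fin ny) ℝ) (R : Matrix (Fin nz) (Fin nz) ℝ)
    (S : Matrix (Fin ny) (Fin ny) ℝ) :
    (1 - Kg A Q C R S * C) * (1 - G * Mg A Q G C R S * C) = 1 - Wtil A Q G C R S * C := by
  unfold Wtil
  simp only [Matrix.mul_sub, Matrix.sub_mul, Matrix.add_mul, Matrix.mul_assoc, Matrix.mul_one,
    Matrix.one_mul]
  abel

lemma rho_eq {ny nz nd : ℕ} (A Q : Matrix (Fin ny) (Fin ny) ℝ) (G : Matrix (Fin ny) (Fin nd) ℝ)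
    (C : Matrix (Fin nz) (Fin ny) ℝ) (R : Matrix (Fin nz) (Fin nz) ℝ)
    (S : Matrix (Fin ny) (Fin ny) ℝ) :
    rho A Q G C R S = (1 - Wtil A Q G C R S * C) * (A * S * Aᵀ + Q) * (1 - Wtil A Q G C R S * C)ᵀ
      + Wtil A Q G C R S * R * (Wtil A Q G C R S)ᵀ := by
  unfold rho Atil Ftil
  rw [Vt_eq]
  generalize 1 - Wtil A Q G C R S * C = V
  simp only [Matrix.mul_add, Matrix.add_mul, Matrix.mul_assoc, Matrix.transpose_mul,
    Matrix.transpose_neg, Matrix.neg_mul, Matrix.mul_neg, neg_neg]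

lemma Wtil_mul {ny nz nd : ℕ} (A Q : Matrix (Fin ny) (Fin ny) ℝ) (G : Matrix (Fin ny) (Fin nd) ℝ)
    (C : Matrix (Fin nz) (Fin ny) ℝ) (R : Matrix (Fin nz) (Fin nz) ℝ)
    (S : Matrix (Fin ny) (Fin ny) ℝ)
    (hN : ((C * G)ᵀ * (Rt A Q C R S)⁻¹ * (C * G)).det ≠ 0) :
    Wtil A Q G C R S * (C * G) = G := by
  have hM : Mg A Q G C R S * (C * G) = 1 := by
    unfold Mg
    rw [Matrix.mul_assoc, Matrix.mul_assoc, ← Matrix.mul_assoc ((C * G)ᵀ)]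
    exact Matrix.nonsing_inv_mul _ (isUnit_iff_ne_zero.2 hN)
  unfold Wtil
  rw [Matrix.add_mul, Matrix.sub_mul, Matrix.mul_assoc, Matrix.mul_assoc _ (Mg A Q G C R S), hM]
  simp only [Matrix.mul_assoc, Matrix.mul_one]
  abel

lemma Wtil_Rt {ny nz nd : ℕ} (A Q : Matrix (Fin ny) (Fin ny) ℝ) (G : Matrix (Fin ny) (Fin nd) ℝ)
    (C : Matrix (Fin nz) (Fin ny) ℝ) (R : Matrix (Fin nz) (Fin nz) ℝ)
    (S : Matrix (Fin ny) (Fin ny) ℝ) (hR : (Rt A Q C R S).det ≠ 0) :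
    ∃ H : Matrix (Fin ny) (Fin nd) ℝ,
      Wtil A Q G C R S * Rt A Q C R S = (A * S * Aᵀ + Q) * Cᵀ + H * (C * G)ᵀ := by
  have hi := Matrix.nonsing_inv_mul _ (isUnit_iff_ne_zero.2 hR)
  refine ⟨(G - Kg A Q C R S * C * G) * ((C * G)ᵀ * (Rt A Q C R S)⁻¹ * (C * G))⁻¹, ?_⟩
  have hM : Mg A Q G C R S * Rt A Q C R S
      = ((C * G)ᵀ * (Rt A Q C R S)⁻¹ * (C * G))⁻¹ * (C * G)ᵀ := by
    unfold Mg
    rw [Matrix.mul_assoc, hi, Matrix.mul_one]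
  have hK : Kg A Q C R S * Rt A Q C R S = (A * S * Aᵀ + Q) * Cᵀ := by
    unfold Kg
    rw [Matrix.mul_assoc, hi, Matrix.mul_one]
  unfold Wtil
  rw [Matrix.add_mul, hK, ← Matrix.sub_mul, Matrix.mul_assoc, hM, ← Matrix.mul_assoc, add_comm]

/-- Orthogonality: any admissible gain may be used on the right. -/
lemma rho_cross {ny nz nd : ℕ} (A Q : Matrix (Fin ny) (Fin ny) ℝ) (G : Matrix (Fin ny) (Fin nd) ℝ)
    (C : Matrix (Fin nz) (Fin ny) ℝ) (R : Matrix (Fin nz) (Fin nz) ℝ)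
    (S : Matrix (Fin ny) (Fin ny) ℝ) (hR : (Rt A Q C R S).det ≠ 0)
    (hN : ((C * G)ᵀ * (Rt A Q C R S)⁻¹ * (C * G)).det ≠ 0)
    (L : Matrix (Fin ny) (Fin nz) ℝ) (hL : L * (C * G) = G) :
    rho A Q G C R S = (1 - Wtil A Q G C R S * C) * (A * S * Aᵀ + Q) * (1 - L * C)ᵀ
      + Wtil A Q G C R S * R * Lᵀ := by
  obtain ⟨H, hH⟩ := Wtil_Rt A Q G C R S hR
  have hW := Wtil_mul A Q G C R S hN
  rw [rho_eq]
  unfold Rt at hH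
  revert hH hW
  generalize Wtil A Q G C R S = W
  generalize A * S * Aᵀ + Q = P
  intro hH hW
  have h0 : (C * G)ᵀ * (W - L)ᵀ = 0 := by
    rw [← Matrix.transpose_mul, Matrix.sub_mul, hW, hL, sub_self, Matrix.transpose_zero]
  have h1 : (W * (C * P * Cᵀ + R) - P * Cᵀ) * (W - L)ᵀ = 0 := by
    rw [hH, add_sub_cancel_left, Matrix.mul_assoc, h0, Matrix.mul_zero]
  rw [← sub_eq_zero, ← h1]
  simp only [Matrix.mul_sub, Matrix.sub_mul, Matrix.mul_add, Matrix.add_mul, Matrix.mul_assoc,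
    Matrix.transpose_sub, Matrix.transpose_mul, Matrix.transpose_one, Matrix.mul_one,
    Matrix.one_mul]
  abel

lemma rho_diff {ny nz nd : ℕ} (A Q : Matrix (Fin ny) (Fin ny) ℝ) (G : Matrix (Fin ny) (Fin nd) ℝ)
    (C : Matrix (Fin nz) (Fin ny) ℝ) (R : Matrix (Fin nz) (Fin nz) ℝ)
    (hQ : Qᵀ = Q) (hRs : Rᵀ = R)
    (S T : Matrix (Fin ny) (Fin ny) ℝ) (hT : Tᵀ = T) (hR : (Rt A Q C R S).det ≠ 0)
    (hN : ((C * G)ᵀ * (Rt A Q C R S)⁻¹ * (C * G)).det ≠ 0)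
    (hR' : (Rt A Q C R T).det ≠ 0)
    (hN' : ((C * G)ᵀ * (Rt A Q C R T)⁻¹ * (C * G)).det ≠ 0) :
    rho A Q G C R T - rho A Q G C R S = (1 - Wtil A Q G C R S * C) * (A * (T - S) * Aᵀ)
      * (1 - Wtil A Q G C R T * C)ᵀ := by
  have hsym : (rho A Q G C R T)ᵀ = rho A Q G C R T := by
    rw [rho_eq]
    simp only [Matrix.transpose_add, Matrix.transpose_mul, Matrix.transpose_transpose, hT, hQ, hRs,
      Matrix.mul_assoc]
  rw [← hsym, rho_cross A Q G C R T hR' hN' _ (Wtil_mul A Q G C R S hN),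
    rho_cross A Q G C R S hR hN _ (Wtil_mul A Q G C R T hN')]
  generalize Wtil A Q G C R S = W
  generalize Wtil A Q G C R T = L
  simp only [Matrix.transpose_add, Matrix.transpose_mul, Matrix.transpose_transpose, hT, hQ, hRs]
  generalize (1 - L * C)ᵀ = V
  generalize (1 - W * C) = U
  simp only [Matrix.mul_sub, Matrix.sub_mul, Matrix.mul_add, Matrix.add_mul, Matrix.mul_assoc]
  abel

lemma Rt_posDef {ny nz : ℕ} (A Q : Matrix (Fin ny) (Fin ny) ℝ)
    (C : Matrix (Fin nz) (Fin ny) ℝ) (R : Matrix (Fin nz) (Fin nz) ℝ)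
    (hQ : Q.PosDef) (hR : R.PosDef) (S : Matrix (Fin ny) (Fin ny) ℝ) (hS : S.PosSemidef) :
    (Rt A Q C R S).PosDef := by
  have h1 : (A * S * Aᵀ).PosSemidef := by
    simpa using hS.mul_mul_conjTranspose_same A
  have h2 : (C * (A * S * Aᵀ + Q) * Cᵀ).PosSemidef := by
    simpa using (h1.add hQ.posSemidef).mul_mul_conjTranspose_same C
  exact Matrix.PosDef.posSemidef_add h2 hR

lemma rank_inj {m n : ℕ} (F : Matrix (Fin m) (Fin n) ℝ) (hF : F.rank = n) :
    Function.Injective F.mulVec := by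
  have h := LinearMap.finrank_range_add_finrank_ker F.mulVecLin
  have h2 : Module.finrank ℝ (LinearMap.range F.mulVecLin) = n := hF
  rw [h2, Module.finrank_fin_fun] at h
  have h3 : LinearMap.ker F.mulVecLin = ⊥ := Submodule.finrank_eq_zero.1 (by omega)
  exact LinearMap.ker_eq_bot.1 h3

lemma inv_cont {n : ℕ} (f : ℝ → Matrix (Fin n) (Fin n) ℝ) (hf : ContinuousAt f 0)
    (h : (f 0).det ≠ 0) : ContinuousAt (fun e => (f e)⁻¹) 0 := by
  have h1 : ContinuousAt Ring.inverse (f 0).det := by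
    rw [Ring.inverse_eq_inv']
    exact continuousAt_inv₀ h
  exact ContinuousAt.comp (g := fun M : Matrix (Fin n) (Fin n) ℝ => M⁻¹) (continuousAt_matrix_inv _ h1) hf

lemma mul_cont {l m n : ℕ} {f : ℝ → Matrix (Fin l) (Fin m) ℝ} {g : ℝ → Matrix (Fin m) (Fin n) ℝ}
    (hf : ContinuousAt f 0) (hg : ContinuousAt g 0) : ContinuousAt (fun e => f e * g e) 0 :=
  ContinuousAt.comp (f := fun e => (f e, g e))
    (g := fun p : Matrix (Fin l) (Fin m) ℝ × Matrix (Fin m) (Fin n) ℝ => p.1 * p.2)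
    (continuous_fst.matrix_mul continuous_snd).continuousAt (hf.prodMk hg)

/-- for PSD `Σ, X`, the map `ε ↦ ρ(Σ + εX)` is differentiable at
`ε = 0` with derivative `Ã(Σ) X Ã(Σ)ᵀ`. -/
theorem state_update_directional_derivative {ny nz nd : ℕ}
    (A Q : Matrix (Fin ny) (Fin ny) ℝ) (G : Matrix (Fin ny) (Fin nd) ℝ)
    (C : Matrix (Fin nz) (Fin ny) ℝ) (R : Matrix (Fin nz) (Fin nz) ℝ)
    (hQ : Q.PosDef) (hR : R.PosDef) (hF : (C * G).rank = nd)
    (S X : Matrix (Fin ny) (Fin ny) ℝ) (hS : S.PosSemidef) (hX : X.PosSemidef) :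
    HasDerivAt (fun ε : ℝ => rho A Q G C R (S + ε • X))
      (Atil A Q G C R S * X * (Atil A Q G C R S)ᵀ) 0 := by
  have hR0 : (Rt A Q C R S).PosDef := Rt_posDef A Q C R hQ hR S hS
  have hN0 : ((C * G)ᵀ * (Rt A Q C R S)⁻¹ * (C * G)).PosDef := by
    simpa using hR0.inv.conjTranspose_mul_mul_same (rank_inj _ hF)
  have hRd := hR0.det_pos.ne'
  have hNd := hN0.det_pos.ne'
  have hz : S + (0 : ℝ) • X = S := by simp
  have cS : Continuous (fun ε : ℝ => S + ε • X) := by fun_prop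
  have cP : ContinuousAt (fun ε : ℝ => A * (S + ε • X) * Aᵀ + Q) 0 :=
    (mul_cont (mul_cont continuousAt_const cS.continuousAt) continuousAt_const).add
      continuousAt_const
  have cR : ContinuousAt (fun ε : ℝ => Rt A Q C R (S + ε • X)) 0 :=
    (mul_cont (mul_cont continuousAt_const cP) continuousAt_const).add continuousAt_const
  have cRi : ContinuousAt (fun ε : ℝ => (Rt A Q C R (S + ε • X))⁻¹) 0 :=
    inv_cont _ cR (by rw [hz]; exact hRd)
  have cN : ContinuousAt
      (fun ε : ℝ => (C * G)ᵀ * (Rt A Q C R (S + ε • X))⁻¹ * (C * G)) 0 :=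
    mul_cont (mul_cont continuousAt_const cRi) continuousAt_const
  have cNi := inv_cont _ cN (by rw [hz]; exact hNd)
  have cM : ContinuousAt (fun ε : ℝ => Mg A Q G C R (S + ε • X)) 0 :=
    mul_cont (mul_cont cNi continuousAt_const) cRi
  have cK : ContinuousAt (fun ε : ℝ => Kg A Q C R (S + ε • X)) 0 :=
    mul_cont (mul_cont cP continuousAt_const) cRi
  have cW : ContinuousAt (fun ε : ℝ => Wtil A Q G C R (S + ε • X)) 0 :=
    ((mul_cont continuousAt_const cM).sub
      (mul_cont (mul_cont (mul_cont cK continuousAt_const) continuousAt_const) cM)).add cK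
  have cV : ContinuousAt (fun ε : ℝ => (1 - Wtil A Q G C R (S + ε • X) * C)ᵀ) 0 :=
    ContinuousAt.comp (g := fun M : Matrix (Fin ny) (Fin ny) ℝ => Mᵀ)
      (continuous_id.matrix_transpose).continuousAt
      (continuousAt_const.sub (mul_cont cW continuousAt_const))
  have cB : ContinuousAt (fun ε : ℝ => (1 - Wtil A Q G C R S * C) * (A * X * Aᵀ)
      * (1 - Wtil A Q G C R (S + ε • X) * C)ᵀ) 0 := mul_cont continuousAt_const cV
  have eR : ∀ᶠ ε : ℝ in nhds 0, (Rt A Q C R (S + ε • X)).det ≠ 0 :=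
    (ContinuousAt.comp (g := fun M : Matrix (Fin nz) (Fin nz) ℝ => M.det)
      continuous_id.matrix_det.continuousAt cR).eventually_ne
        (by simpa only [Function.comp, hz] using hRd)
  have eN : ∀ᶠ ε : ℝ in nhds 0,
      ((C * G)ᵀ * (Rt A Q C R (S + ε • X))⁻¹ * (C * G)).det ≠ 0 :=
    (ContinuousAt.comp (g := fun M : Matrix (Fin nd) (Fin nd) ℝ => M.det)
      continuous_id.matrix_det.continuousAt cN).eventually_ne
        (by simpa only [Function.comp, hz] using hNd)
  have hSt : Sᵀ = S := by simpa using hS.isHermitian.eq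
  have hXt : Xᵀ = X := by simpa using hX.isHermitian.eq
  have hQt : Qᵀ = Q := by simpa using hQ.isHermitian.eq
  have hRt : Rᵀ = R := by simpa using hR.isHermitian.eq
  have hval : Atil A Q G C R S * X * (Atil A Q G C R S)ᵀ
      = (1 - Wtil A Q G C R S * C) * (A * X * Aᵀ)
      * (1 - Wtil A Q G C R (S + (0 : ℝ) • X) * C)ᵀ := by
    unfold Atil
    rw [Vt_eq, hz]
    generalize 1 - Wtil A Q G C R S * C = V
    simp only [Matrix.transpose_mul, Matrix.mul_assoc]
  rw [hval]
  refine (hasDerivAt_iff_tendsto_slope_zero (F := Matrix (Fin ny) (Fin ny) ℝ)).2 ?_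
  refine (cB.tendsto.mono_left nhdsWithin_le_nhds).congr' ?_
  filter_upwards [eR.filter_mono nhdsWithin_le_nhds, eN.filter_mono nhdsWithin_le_nhds,
    self_mem_nhdsWithin] with ε h1 h2 h3
  have h3' : ε ≠ 0 := h3
  rw [zero_add, hz, rho_diff A Q G C R hQt hRt S (S + ε • X)
    (by rw [Matrix.transpose_add, Matrix.transpose_smul, hSt, hXt]) hRd hNd h1 h2,
    add_sub_cancel_left]
  simp only [Matrix.mul_smul, Matrix.smul_mul, smul_smul, inv_mul_cancel₀ h3', one_smul]
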